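/- arXiv:2406.12856 — 3 statements merged into one kernel-verified Lean document; each statement's English description precedes it below -/
import Mathlib

section
/- Uniqueness of the solution (Theorem 5.2): Assume λ·αj < 1 for j = 1, 2, 3, where α1 = (F31+F21)/V1, α2 = F32/V2, α3 = F13/V3. If (L1, L2, L3) and (L1*, L2*, L3*) are both solutions of the FF polluted-lake integral system with the same initial data L1,0, L2,0, L3,0 ∈ ℝ, then Lj(s) = Lj*(s) for all s ∈ J and j = 1, 2, 3. -/
open Set MeasureTheory

/-- The Atangana–Baleanu normalization constant `AB(θ) = 1 - θ + θ/Γ(θ)`. -/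
noncomputable def AB (θ : ℝ) : ℝ := 1 - θ + θ / Real.Gamma θ

/-- The fractal-fractional integral of order `(θ, σ)` with Mittag–Leffler type kernel. -/
noncomputable def ffInt (θ σ : ℝ) (f : ℝ → ℝ) (s : ℝ) : ℝ :=
  (1 - θ) * σ * s ^ (σ - 1) / AB θ * f s
    + θ * σ / (AB θ * Real.Gamma θ)
        * ∫ w in (0:ℝ)..s, w ^ (σ - 1) * (s - w) ^ (θ - 1) * f w

/-- The constant `λ` appearing in the a priori estimates. -/
noncomputable def lam (θ σ S : ℝ) : ℝ :=
  (1 - θ) * σ * S ^ (σ - 1) / AB θ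
    + θ * σ * S ^ (θ + σ - 1) * Real.Gamma σ / (AB θ * Real.Gamma (θ + σ))

/-- Kernel of the first lake: `Q1(s,x,y,z) = (F13/V3)z + c(s) − ((F31+F21)/V1)x`. -/
noncomputable def Q1 (F13 F31 F21 V1 V3 : ℝ) (c : ℝ → ℝ) (s x y z : ℝ) : ℝ :=
  F13 / V3 * z + c s - (F31 + F21) / V1 * x

/-- Kernel of the second lake: `Q2(s,x,y,z) = (F21/V1)x − (F32/V2)y`. -/
noncomputable def Q2 (F21 F32 V1 V2 : ℝ) (s x y z : ℝ) : ℝ :=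
  F21 / V1 * x - F32 / V2 * y

/-- Kernel of the third lake: `Q3(s,x,y,z) = (F31/V1)x + (F32/V2)y − (F13/V3)z`. -/
noncomputable def Q3 (F13 F31 F32 V1 V2 V3 : ℝ) (s x y z : ℝ) : ℝ :=
  F31 / V1 * x + F32 / V2 * y - F13 / V3 * z

open Filter Topology

/-- The real Beta kernel is integrable on the unit interval. -/
lemma intervalIntegrable_betaKernel_one {x y : ℝ} (hx : 0 < x) (hy : 0 < y) :
    IntervalIntegrable (fun w : ℝ => w ^ (x - 1) * (1 - w) ^ (y - 1)) volume 0 1 := by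
  have h := (Complex.betaIntegral_convergent (u := x) (v := y) (by simpa) (by simpa)).norm
  refine IntervalIntegrable.congr (fun w hw => ?_) h
  rw [uIoc_of_le zero_le_one] at hw
  have h1 : (0 : ℝ) ≤ 1 - w := by linarith [hw.2]
  have e1 : ((w : ℂ) ^ ((x : ℂ) - 1)) = ((w ^ (x - 1) : ℝ) : ℂ) := by
    rw [Complex.ofReal_cpow hw.1.le]; push_cast; rfl
  have e2 : ((1 - (w : ℂ)) ^ ((y : ℂ) - 1)) = (((1 - w) ^ (y - 1) : ℝ) : ℂ) := by
    rw [Complex.ofReal_cpow h1]; push_cast; rfl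
  simp only [e1, e2, ← Complex.ofReal_mul, Complex.norm_real]
  exact Real.norm_of_nonneg
    (mul_nonneg (Real.rpow_nonneg hw.1.le _) (Real.rpow_nonneg h1 _))

/-- Homogeneity of the Beta kernel. -/
lemma betaKernel_mul {x y s w : ℝ} (hs : 0 < s) (hw : w ∈ Icc (0 : ℝ) 1) :
    (s * w) ^ (x - 1) * (s - s * w) ^ (y - 1)
      = s ^ (x + y - 2) * (w ^ (x - 1) * (1 - w) ^ (y - 1)) := by
  have h1 : s - s * w = s * (1 - w) := by ring
  rw [h1, Real.mul_rpow hs.le hw.1, Real.mul_rpow hs.le (by linarith [hw.2]),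
    show x + y - 2 = (x - 1) + (y - 1) by ring, Real.rpow_add hs]
  ring

/-- The Beta kernel is integrable on every interval `[0, s]`. -/
lemma intervalIntegrable_betaKernel {x y s : ℝ} (hx : 0 < x) (hy : 0 < y) (hs : 0 ≤ s) :
    IntervalIntegrable (fun w : ℝ => w ^ (x - 1) * (s - w) ^ (y - 1)) volume 0 s := by
  rcases hs.eq_or_lt with rfl | hs
  · simp
  have h := ((intervalIntegrable_betaKernel_one hx hy).comp_mul_left (c := s⁻¹)).const_mul
    (s ^ (x + y - 2))
  simp only [zero_div, one_div, inv_inv] at h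
  refine IntervalIntegrable.congr (fun w hw => ?_) h
  rw [uIoc_of_le hs.le] at hw
  have hw' : s⁻¹ * w ∈ Icc (0 : ℝ) 1 :=
    ⟨by have := hw.1; positivity, by rw [inv_mul_le_one₀ hs]; exact hw.2⟩
  have := betaKernel_mul (x := x) (y := y) hs hw'
  rw [mul_inv_cancel_left₀ hs.ne'] at this
  exact this.symm

/-- Scaling of the incomplete Beta integral. -/
lemma integral_betaKernel {x y s : ℝ} (hs : 0 < s) :
    ∫ w in (0 : ℝ)..s, w ^ (x - 1) * (s - w) ^ (y - 1)
      = s ^ (x + y - 1) * ∫ w in (0 : ℝ)..1, w ^ (x - 1) * (1 - w) ^ (y - 1) := by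
  have h := intervalIntegral.smul_integral_comp_mul_left (a := 0) (b := 1)
    (fun w : ℝ => w ^ (x - 1) * (s - w) ^ (y - 1)) s
  rw [mul_zero, mul_one] at h
  rw [← h, intervalIntegral.integral_congr (g := fun w : ℝ =>
    s ^ (x + y - 2) * (w ^ (x - 1) * (1 - w) ^ (y - 1)))
    (fun w hw => betaKernel_mul hs (by rwa [uIcc_of_le zero_le_one] at hw)),
    intervalIntegral.integral_const_mul, smul_eq_mul, ← mul_assoc,
    show x + y - 1 = 1 + (x + y - 2) by ring, Real.rpow_add hs, Real.rpow_one]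

/-- The Beta integral tends to `0` when its first argument tends to infinity. -/
lemma tendsto_betaIntegral_atTop {x y : ℝ} (hx : 0 < x) (hy : 0 < y) :
    Tendsto (fun r : ℝ => ∫ w in (0 : ℝ)..1, w ^ (x + r - 1) * (1 - w) ^ (y - 1))
      atTop (𝓝 0) := by
  have key : Tendsto (fun r : ℝ => ∫ w in (0 : ℝ)..1, w ^ (x + r - 1) * (1 - w) ^ (y - 1))
      atTop (𝓝 (∫ _ in (0 : ℝ)..1, (0 : ℝ))) := by
    refine intervalIntegral.tendsto_integral_filter_of_dominated_convergence
      (fun w : ℝ => w ^ (x - 1) * (1 - w) ^ (y - 1)) ?_ ?_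
      (intervalIntegrable_betaKernel_one hx hy) ?_
    · exact Eventually.of_forall fun r => by
        apply Measurable.aestronglyMeasurable
        fun_prop
    · filter_upwards [eventually_ge_atTop 0] with r hr
      refine Eventually.of_forall fun w hw => ?_
      rw [uIoc_of_le zero_le_one] at hw
      have h1 : (0 : ℝ) ≤ 1 - w := by linarith [hw.2]
      rw [Real.norm_of_nonneg
        (mul_nonneg (Real.rpow_nonneg hw.1.le _) (Real.rpow_nonneg h1 _))]
      exact mul_le_mul_of_nonneg_right
        (Real.rpow_le_rpow_of_exponent_ge hw.1 hw.2 (by linarith)) (Real.rpow_nonneg h1 _)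
    · filter_upwards [Measure.ae_ne volume (1 : ℝ)] with w hw1 hw
      rw [uIoc_of_le zero_le_one] at hw
      have h := (tendsto_rpow_atTop_of_base_lt_one w (by linarith [hw.1])
        (lt_of_le_of_ne hw.2 hw1)).const_mul (w ^ (x - 1) * (1 - w) ^ (y - 1))
      rw [mul_zero] at h
      refine h.congr fun r => ?_
      rw [show x + r - 1 = (x - 1) + r by ring, Real.rpow_add hw.1]
      ring
  simpa using key

/-- A bound by a power is improved by the weakly singular Volterra operator. -/
lemma volterra_power_bound {S θ σ K p r A : ℝ} {u : ℝ → ℝ} (hθ : 0 < θ) (hσ : 0 < σ)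
    (hK : 0 ≤ K) (hr : 0 ≤ r) (hu : ContinuousOn u (Icc 0 S))
    (hineq : ∀ s ∈ Ioc 0 S,
      u s ≤ K * s ^ p * ∫ w in (0 : ℝ)..s, w ^ (σ - 1) * (s - w) ^ (θ - 1) * u w)
    (hA : ∀ s ∈ Ioc 0 S, u s ≤ A * s ^ r) :
    ∀ s ∈ Ioc 0 S, u s ≤
      A * (K * ∫ w in (0 : ℝ)..1, w ^ (σ + r - 1) * (1 - w) ^ (θ - 1))
        * s ^ (r + (p + σ + θ - 1)) := by
  intro s hs
  have hmono : ∫ w in (0 : ℝ)..s, w ^ (σ - 1) * (s - w) ^ (θ - 1) * u w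
      ≤ ∫ w in (0 : ℝ)..s, A * (w ^ (σ + r - 1) * (s - w) ^ (θ - 1)) := by
    refine intervalIntegral.integral_mono_on_of_le_Ioo hs.1.le ?_ ?_ ?_
    · refine (intervalIntegrable_betaKernel hσ hθ hs.1.le).mul_continuousOn (hu.mono ?_)
      rw [uIcc_of_le hs.1.le]
      exact Icc_subset_Icc_right hs.2
    · exact (intervalIntegrable_betaKernel (by linarith) hθ hs.1.le).const_mul A
    · intro w hw
      calc w ^ (σ - 1) * (s - w) ^ (θ - 1) * u w
          ≤ w ^ (σ - 1) * (s - w) ^ (θ - 1) * (A * w ^ r) :=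
            mul_le_mul_of_nonneg_left (hA w ⟨hw.1, hw.2.le.trans hs.2⟩)
              (mul_nonneg (Real.rpow_nonneg hw.1.le _)
                (Real.rpow_nonneg (by linarith [hw.2]) _))
        _ = A * (w ^ (σ + r - 1) * (s - w) ^ (θ - 1)) := by
            rw [show σ + r - 1 = (σ - 1) + r by ring, Real.rpow_add hw.1]
            ring
  rw [intervalIntegral.integral_const_mul, integral_betaKernel hs.1] at hmono
  refine (hineq s hs).trans ((mul_le_mul_of_nonneg_left hmono
    (mul_nonneg hK (Real.rpow_nonneg hs.1.le _))).trans_eq ?_)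
  rw [show r + (p + σ + θ - 1) = p + (σ + r + θ - 1) by ring, Real.rpow_add hs.1]
  ring

/-- Gronwall-type lemma for weakly singular Volterra inequalities. -/
lemma eq_zero_of_le_volterra {S θ σ K p : ℝ} {u : ℝ → ℝ} (hS : 0 < S) (hθ : 0 < θ) (hσ : 0 < σ)
    (hK : 0 ≤ K) (hp : 0 < p + σ + θ - 1) (hu : ContinuousOn u (Icc 0 S))
    (hu0 : ∀ s, 0 ≤ u s)
    (hineq : ∀ s ∈ Ioc 0 S,
      u s ≤ K * s ^ p * ∫ w in (0 : ℝ)..s, w ^ (σ - 1) * (s - w) ^ (θ - 1) * u w) :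
    ∀ s ∈ Icc 0 S, u s = 0 := by
  set γ := p + σ + θ - 1 with hγ
  have hpow : ∀ n : ℕ, ∃ A : ℝ, 0 ≤ A ∧ ∀ s ∈ Ioc 0 S, u s ≤ A * s ^ (n * γ) := by
    intro n
    induction n with
    | zero =>
      obtain ⟨A, hA⟩ := isCompact_Icc.exists_bound_of_continuousOn hu
      refine ⟨A, (norm_nonneg _).trans (hA 0 (left_mem_Icc.2 hS.le)), fun s hs => ?_⟩
      simpa using (le_abs_self _).trans (hA s (Ioc_subset_Icc_self hs))
    | succ n ih =>
      obtain ⟨A, hA0, hA⟩ := ih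
      refine ⟨A * (K * ∫ w in (0 : ℝ)..1, w ^ (σ + n * γ - 1) * (1 - w) ^ (θ - 1)), ?_,
        fun s hs => ?_⟩
      · refine mul_nonneg hA0 (mul_nonneg hK
          (intervalIntegral.integral_nonneg zero_le_one fun w hw => ?_))
        exact mul_nonneg (Real.rpow_nonneg hw.1 _) (Real.rpow_nonneg (by linarith [hw.2]) _)
      · have := volterra_power_bound hθ hσ hK (by positivity) hu hineq hA s hs
        rwa [← hγ, show (n : ℝ) * γ + γ = ((n + 1 : ℕ) : ℝ) * γ by push_cast; ring] at this
  have hlim : Tendsto (fun n : ℕ => K * (∫ w in (0 : ℝ)..1,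
      w ^ (σ + n * γ - 1) * (1 - w) ^ (θ - 1)) * S ^ γ) atTop (𝓝 0) := by
    have := (((tendsto_betaIntegral_atTop hσ hθ).comp
      (tendsto_natCast_atTop_atTop.atTop_mul_const hp)).const_mul K).mul_const (S ^ γ)
    simpa using this
  obtain ⟨n, hn⟩ := (hlim.eventually_lt_const (u := 1 / 2) (by norm_num)).exists
  obtain ⟨A, hA0, hA⟩ := hpow n
  have hhalf : ∀ m : ℕ, ∀ s ∈ Ioc 0 S, u s ≤ A * (1 / 2) ^ m * s ^ (n * γ) := by
    intro m
    induction m with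
    | zero => simpa using hA
    | succ m ih =>
      intro s hs
      have h := volterra_power_bound hθ hσ hK (by positivity) hu hineq ih s hs
      rw [← hγ, Real.rpow_add hs.1] at h
      refine h.trans ?_
      set B := ∫ w in (0 : ℝ)..1, w ^ (σ + n * γ - 1) * (1 - w) ^ (θ - 1) with hB
      have hB0 : 0 ≤ B := intervalIntegral.integral_nonneg zero_le_one fun w hw =>
        mul_nonneg (Real.rpow_nonneg hw.1 _) (Real.rpow_nonneg (by linarith [hw.2]) _)
      have hsS : K * B * s ^ γ ≤ 1 / 2 :=
        (mul_le_mul_of_nonneg_left (Real.rpow_le_rpow hs.1.le hs.2 hp.le)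
          (mul_nonneg hK hB0)).trans hn.le
      have hc : 0 ≤ A * (1 / 2) ^ m * s ^ (n * γ) :=
        mul_nonneg (by positivity) (Real.rpow_nonneg hs.1.le _)
      calc A * (1 / 2) ^ m * (K * B) * (s ^ (n * γ) * s ^ γ)
          = A * (1 / 2) ^ m * s ^ (n * γ) * (K * B * s ^ γ) := by ring
        _ ≤ A * (1 / 2) ^ m * s ^ (n * γ) * (1 / 2) := mul_le_mul_of_nonneg_left hsS hc
        _ = A * (1 / 2) ^ (m + 1) * s ^ (n * γ) := by ring
  have hIoc : EqOn u (fun _ => 0) (Ioc 0 S) := by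
    intro s hs
    refine le_antisymm ?_ (hu0 s)
    have ht : Tendsto (fun m : ℕ => A * (1 / 2) ^ m * s ^ (n * γ)) atTop (𝓝 0) := by
      simpa using ((tendsto_pow_atTop_nhds_zero_of_lt_one (r := (1 / 2 : ℝ)) (by norm_num)
        (by norm_num)).const_mul A).mul_const (s ^ (n * γ))
    exact ge_of_tendsto' ht fun m => hhalf m s hs
  exact hIoc.of_subset_closure hu continuousOn_const Ioc_subset_Icc_self
    (closure_Ioc hS.ne).superset

lemma AB_pos {θ : ℝ} (hθ : θ ∈ Ioc (0 : ℝ) 1) : 0 < AB θ := by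
  have h := div_pos hθ.1 (Real.Gamma_pos_of_pos hθ.1)
  unfold AB
  linarith [hθ.2]

/-- A continuous function times the fractal-fractional kernel is integrable. -/
lemma intervalIntegrable_betaKernel_mul {S θ σ s : ℝ} {f : ℝ → ℝ} (hθ : 0 < θ) (hσ : 0 < σ)
    (hf : ContinuousOn f (Icc 0 S)) (hs : s ∈ Icc 0 S) :
    IntervalIntegrable (fun w : ℝ => w ^ (σ - 1) * (s - w) ^ (θ - 1) * f w) volume 0 s := by
  refine (intervalIntegrable_betaKernel hσ hθ hs.1).mul_continuousOn (hf.mono ?_)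
  rw [uIcc_of_le hs.1]
  exact Icc_subset_Icc_right hs.2

lemma ffInt_sub {S θ σ s : ℝ} {f g : ℝ → ℝ} (hθ : 0 < θ) (hσ : 0 < σ)
    (hf : ContinuousOn f (Icc 0 S)) (hg : ContinuousOn g (Icc 0 S)) (hs : s ∈ Icc 0 S) :
    ffInt θ σ (fun r => f r - g r) s = ffInt θ σ f s - ffInt θ σ g s := by
  simp only [ffInt, mul_sub]
  rw [intervalIntegral.integral_sub (intervalIntegrable_betaKernel_mul hθ hσ hf hs)
    (intervalIntegrable_betaKernel_mul hθ hσ hg hs)]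
  ring

lemma ffInt_const_mul (θ σ a s : ℝ) (f : ℝ → ℝ) :
    ffInt θ σ (fun r => a * f r) s = a * ffInt θ σ f s := by
  simp only [ffInt, mul_left_comm _ a, intervalIntegral.integral_const_mul]
  ring

/-- The resolvent of a three-compartment conservative exchange matrix is an `ℓ¹` contraction. -/
lemma compartment_resolvent_bound {a p q b t h1 h2 h3 g1 g2 g3 : ℝ} (ha : 0 ≤ a) (hp : 0 ≤ p)
    (hq : 0 ≤ q) (hb : 0 ≤ b) (ht : 0 ≤ t)
    (e1 : h1 = a * (t * h3 - (p + q) * h1) + g1)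
    (e2 : h2 = a * (p * h1 - b * h2) + g2)
    (e3 : h3 = a * (q * h1 + b * h2 - t * h3) + g3) :
    |h1| + |h2| + |h3| ≤ |g1| + |g2| + |g3| := by
  have k1 : (1 + a * (p + q)) * |h1| ≤ |g1| + a * t * |h3| := by
    rw [← abs_of_nonneg (show 0 ≤ 1 + a * (p + q) by positivity),
      ← abs_of_nonneg (show 0 ≤ a * t by positivity), ← abs_mul, ← abs_mul,
      show (1 + a * (p + q)) * h1 = g1 + a * t * h3 by linarith]
    exact abs_add_le _ _
  have k2 : (1 + a * b) * |h2| ≤ |g2| + a * p * |h1| := by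
    rw [← abs_of_nonneg (show 0 ≤ 1 + a * b by positivity),
      ← abs_of_nonneg (show 0 ≤ a * p by positivity), ← abs_mul, ← abs_mul,
      show (1 + a * b) * h2 = g2 + a * p * h1 by linarith]
    exact abs_add_le _ _
  have k3 : (1 + a * t) * |h3| ≤ |g3| + a * q * |h1| + a * b * |h2| := by
    rw [← abs_of_nonneg (show 0 ≤ 1 + a * t by positivity),
      ← abs_of_nonneg (show 0 ≤ a * q by positivity),
      ← abs_of_nonneg (show 0 ≤ a * b by positivity), ← abs_mul, ← abs_mul, ← abs_mul,
      show (1 + a * t) * h3 = g3 + a * q * h1 + a * b * h2 by linarith]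
    exact abs_add_three _ _ _
  linarith

/-- A continuous solution of the homogeneous conservative three-compartment system vanishes. -/
lemma eq_zero_of_homogeneous {S θ σ p q b t : ℝ} {d1 d2 d3 : ℝ → ℝ} (hS : 0 < S)
    (hθ : θ ∈ Ioc (0 : ℝ) 1) (hσ : σ ∈ Ioc (0 : ℝ) 1)
    (hp : 0 ≤ p) (hq : 0 ≤ q) (hb : 0 ≤ b) (ht : 0 ≤ t)
    (hd1 : ContinuousOn d1 (Icc 0 S)) (hd2 : ContinuousOn d2 (Icc 0 S))
    (hd3 : ContinuousOn d3 (Icc 0 S))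
    (e1 : ∀ s ∈ Icc 0 S, d1 s = t * ffInt θ σ d3 s - (p + q) * ffInt θ σ d1 s)
    (e2 : ∀ s ∈ Icc 0 S, d2 s = p * ffInt θ σ d1 s - b * ffInt θ σ d2 s)
    (e3 : ∀ s ∈ Icc 0 S,
      d3 s = q * ffInt θ σ d1 s + b * ffInt θ σ d2 s - t * ffInt θ σ d3 s) :
    ∀ s ∈ Icc 0 S, |d1 s| + |d2 s| + |d3 s| = 0 := by
  have hAB := AB_pos hθ
  set C := θ * σ / (AB θ * Real.Gamma θ) with hC
  have hC0 : 0 ≤ C := div_nonneg (mul_nonneg hθ.1.le hσ.1.le)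
    (mul_nonneg hAB.le (Real.Gamma_pos_of_pos hθ.1).le)
  set u : ℝ → ℝ := fun s => |d1 s| + |d2 s| + |d3 s| with hu_def
  have hu : ContinuousOn u (Icc 0 S) := (hd1.abs.add hd2.abs).add hd3.abs
  have hu0 : ∀ s, 0 ≤ u s := fun s => by positivity
  set J : (ℝ → ℝ) → ℝ → ℝ := fun f s =>
    ∫ w in (0 : ℝ)..s, w ^ (σ - 1) * (s - w) ^ (θ - 1) * f w with hJ
  have habs : ∀ (f : ℝ → ℝ) (s : ℝ), 0 ≤ s → |C * J f s| ≤ C * J (fun w => |f w|) s := by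
    intro f s hs
    rw [abs_mul, abs_of_nonneg hC0]
    refine mul_le_mul_of_nonneg_left ?_ hC0
    refine (intervalIntegral.abs_integral_le_integral_abs hs).trans_eq ?_
    refine intervalIntegral.integral_congr fun w hw => ?_
    rw [uIcc_of_le hs] at hw
    simp only [abs_mul]
    rw [abs_of_nonneg (Real.rpow_nonneg hw.1 _),
      abs_of_nonneg (Real.rpow_nonneg (sub_nonneg.2 hw.2) _)]
  have hJu : ∀ s ∈ Icc 0 S, |C * J d1 s| + |C * J d2 s| + |C * J d3 s| ≤ C * J u s := by
    intro s hs
    have i1 := intervalIntegrable_betaKernel_mul hθ.1 hσ.1 hd1.abs hs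
    have i2 := intervalIntegrable_betaKernel_mul hθ.1 hσ.1 hd2.abs hs
    have i3 := intervalIntegrable_betaKernel_mul hθ.1 hσ.1 hd3.abs hs
    have : J u s = J (fun w => |d1 w|) s + J (fun w => |d2 w|) s + J (fun w => |d3 w|) s := by
      simp only [hJ, hu_def, mul_add]
      rw [intervalIntegral.integral_add (i1.add i2) i3, intervalIntegral.integral_add i1 i2]
    rw [this]
    linarith [habs d1 s hs.1, habs d2 s hs.1, habs d3 s hs.1]
  set a0 := (1 - θ) * σ / AB θ with ha0
  have ha0' : 0 ≤ a0 := div_nonneg (mul_nonneg (by linarith [hθ.2]) hσ.1.le) hAB.le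
  have hff : ∀ (f : ℝ → ℝ) (s : ℝ), ffInt θ σ f s = a0 * s ^ (σ - 1) * f s + C * J f s := by
    intro f s
    simp only [ffInt, ha0, hC, hJ]
    ring
  have hres : ∀ s ∈ Icc 0 S,
      |ffInt θ σ d1 s| + |ffInt θ σ d2 s| + |ffInt θ σ d3 s| ≤ C * J u s := by
    intro s hs
    refine (compartment_resolvent_bound (a := a0 * s ^ (σ - 1))
      (mul_nonneg ha0' (Real.rpow_nonneg hs.1 _)) hp hq hb ht ?_ ?_ ?_).trans (hJu s hs)
    · rw [← e1 s hs, hff]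
    · rw [← e2 s hs, hff]
    · rw [← e3 s hs, hff]
  rcases hθ.2.eq_or_lt with h1 | h1
  · refine eq_zero_of_le_volterra (p := 0) (K := 2 * (p + q + b + t) * C) hS hθ.1 hσ.1
      (by positivity) (by linarith [hσ.1]) hu hu0 fun s hs => ?_
    have hs' := Ioc_subset_Icc_self hs
    have b1 : |d1 s| ≤ t * |ffInt θ σ d3 s| + (p + q) * |ffInt θ σ d1 s| := by
      rw [e1 s hs']
      refine (abs_sub _ _).trans_eq ?_
      rw [abs_mul, abs_mul, abs_of_nonneg ht, abs_of_nonneg (add_nonneg hp hq)]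
    have b2 : |d2 s| ≤ p * |ffInt θ σ d1 s| + b * |ffInt θ σ d2 s| := by
      rw [e2 s hs']
      refine (abs_sub _ _).trans_eq ?_
      rw [abs_mul, abs_mul, abs_of_nonneg hp, abs_of_nonneg hb]
    have b3 : |d3 s| ≤ q * |ffInt θ σ d1 s| + b * |ffInt θ σ d2 s| + t * |ffInt θ σ d3 s| := by
      rw [e3 s hs']
      refine (abs_sub _ _).trans ((add_le_add_left (abs_add_le _ _) _).trans_eq ?_)
      rw [abs_mul, abs_mul, abs_mul, abs_of_nonneg hq, abs_of_nonneg hb, abs_of_nonneg ht]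
    have hsum : u s ≤ 2 * (p + q + b + t) *
        (|ffInt θ σ d1 s| + |ffInt θ σ d2 s| + |ffInt θ σ d3 s|) := by
      have n1 := abs_nonneg (ffInt θ σ d1 s)
      have n2 := abs_nonneg (ffInt θ σ d2 s)
      have n3 := abs_nonneg (ffInt θ σ d3 s)
      have m1 : 0 ≤ (b + t) * |ffInt θ σ d1 s| := by positivity
      have m2 : 0 ≤ (p + q + t) * |ffInt θ σ d2 s| := by positivity
      have m3 : 0 ≤ (p + q + b) * |ffInt θ σ d3 s| := by positivity
      simp only [hu_def]
      linarith
    rw [Real.rpow_zero, mul_one, mul_assoc]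
    exact hsum.trans (mul_le_mul_of_nonneg_left (hres s hs') (by positivity))
  · have ha0p : 0 < a0 := div_pos (mul_pos (by linarith) hσ.1) hAB
    refine eq_zero_of_le_volterra (p := 1 - σ) (K := 2 * C / a0) hS hθ.1 hσ.1
      (by positivity) (by linarith [hθ.1]) hu hu0 fun s hs => ?_
    have hs' := Ioc_subset_Icc_self hs
    have ha : 0 < a0 * s ^ (σ - 1) := mul_pos ha0p (Real.rpow_pos_of_pos hs.1 _)
    have bound : ∀ f : ℝ → ℝ,
        a0 * s ^ (σ - 1) * |f s| ≤ |ffInt θ σ f s| + |C * J f s| := by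
      intro f
      have : a0 * s ^ (σ - 1) * f s = ffInt θ σ f s - C * J f s := by rw [hff]; ring
      rw [← abs_of_pos ha, ← abs_mul, this]
      exact abs_sub _ _
    have hsum : a0 * s ^ (σ - 1) * u s ≤ 2 * C * J u s := by
      simp only [hu_def, mul_add]
      linarith [bound d1, bound d2, bound d3, hres s hs', hJu s hs']
    have hinv : s ^ (1 - σ) * s ^ (σ - 1) = 1 := by
      rw [← Real.rpow_add hs.1]; simp
    calc u s = (s ^ (1 - σ) / a0) * (a0 * s ^ (σ - 1) * u s) := by
          field_simp
          rw [mul_assoc, hinv, mul_one]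
      _ ≤ (s ^ (1 - σ) / a0) * (2 * C * J u s) :=
          mul_le_mul_of_nonneg_left hsum (div_nonneg (Real.rpow_nonneg hs.1.le _) ha0p.le)
      _ = 2 * C / a0 * s ^ (1 - σ) * J u s := by ring

/-- Uniqueness of the solution of the FF polluted-lake integral system (Theorem 5.2). -/
theorem uniqueness_of_solution
    (S θ σ F13 F31 F21 F32 V1 V2 V3 : ℝ)
    (hS : 0 < S) (hθ : θ ∈ Ioc (0:ℝ) 1) (hσ : σ ∈ Ioc (0:ℝ) 1)
    (hF13 : 0 < F13) (hF31 : 0 < F31) (hF21 : 0 < F21) (hF32 : 0 < F32)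
    (hV1 : 0 < V1) (hV2 : 0 < V2) (hV3 : 0 < V3)
    (c : ℝ → ℝ) (hc : ContinuousOn c (Icc 0 S))
    (hcontr1 : lam θ σ S * ((F31 + F21) / V1) < 1)
    (hcontr2 : lam θ σ S * (F32 / V2) < 1)
    (hcontr3 : lam θ σ S * (F13 / V3) < 1)
    (L10 L20 L30 : ℝ)
    (L1 L2 L3 L1' L2' L3' : ℝ → ℝ)
    (hL1 : ContinuousOn L1 (Icc 0 S)) (hL2 : ContinuousOn L2 (Icc 0 S))
    (hL3 : ContinuousOn L3 (Icc 0 S))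
    (hL1' : ContinuousOn L1' (Icc 0 S)) (hL2' : ContinuousOn L2' (Icc 0 S))
    (hL3' : ContinuousOn L3' (Icc 0 S))
    (hE1 : ∀ s ∈ Icc (0:ℝ) S, L1 s = L10 +
      ffInt θ σ (fun r => Q1 F13 F31 F21 V1 V3 c r (L1 r) (L2 r) (L3 r)) s)
    (hE2 : ∀ s ∈ Icc (0:ℝ) S, L2 s = L20 +
      ffInt θ σ (fun r => Q2 F21 F32 V1 V2 r (L1 r) (L2 r) (L3 r)) s)
    (hE3 : ∀ s ∈ Icc (0:ℝ) S, L3 s = L30 +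
      ffInt θ σ (fun r => Q3 F13 F31 F32 V1 V2 V3 r (L1 r) (L2 r) (L3 r)) s)
    (hE1' : ∀ s ∈ Icc (0:ℝ) S, L1' s = L10 +
      ffInt θ σ (fun r => Q1 F13 F31 F21 V1 V3 c r (L1' r) (L2' r) (L3' r)) s)
    (hE2' : ∀ s ∈ Icc (0:ℝ) S, L2' s = L20 +
      ffInt θ σ (fun r => Q2 F21 F32 V1 V2 r (L1' r) (L2' r) (L3' r)) s)
    (hE3' : ∀ s ∈ Icc (0:ℝ) S, L3' s = L30 +
      ffInt θ σ (fun r => Q3 F13 F31 F32 V1 V2 V3 r (L1' r) (L2' r) (L3' r)) s) :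
    ∀ s ∈ Icc (0:ℝ) S, L1 s = L1' s ∧ L2 s = L2' s ∧ L3 s = L3' s := by
  have lin : ∀ (k m : ℝ) (f g : ℝ → ℝ), ContinuousOn f (Icc 0 S) → ContinuousOn g (Icc 0 S) →
      ∀ s ∈ Icc 0 S, ffInt θ σ (fun r => k * f r - m * g r) s
        = k * ffInt θ σ f s - m * ffInt θ σ g s := by
    intro k m f g hf hg s hs
    rw [ffInt_sub hθ.1 hσ.1 (hf.const_mul k) (hg.const_mul m) hs, ffInt_const_mul,
      ffInt_const_mul]
  have c1 := hL1.sub hL1'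
  have c2 := hL2.sub hL2'
  have c3 := hL3.sub hL3'
  have key := eq_zero_of_homogeneous (p := F21 / V1) (q := F31 / V1) (b := F32 / V2)
    (t := F13 / V3) hS hθ hσ (by positivity) (by positivity) (by positivity) (by positivity)
    c1 c2 c3 ?_ ?_ ?_
  · intro s hs
    have h := key s hs
    have n1 := abs_nonneg (L1 s - L1' s)
    have n2 := abs_nonneg (L2 s - L2' s)
    have n3 := abs_nonneg (L3 s - L3' s)
    simp only [Pi.sub_apply] at h
    exact ⟨sub_eq_zero.1 (abs_eq_zero.1 (by linarith)),
      sub_eq_zero.1 (abs_eq_zero.1 (by linarith)), sub_eq_zero.1 (abs_eq_zero.1 (by linarith))⟩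
  · intro s hs
    rw [Pi.sub_apply, hE1 s hs, hE1' s hs, add_sub_add_left_eq_sub,
      ← ffInt_sub hθ.1 hσ.1 (by unfold Q1; fun_prop) (by unfold Q1; fun_prop) hs,
      ← add_div, add_comm F21, ← lin _ _ _ _ c3 c1 s hs]
    congr 1
    funext r
    simp only [Q1, Pi.sub_apply]
    ring
  · intro s hs
    rw [Pi.sub_apply, hE2 s hs, hE2' s hs, add_sub_add_left_eq_sub,
      ← ffInt_sub hθ.1 hσ.1 (by unfold Q2; fun_prop) (by unfold Q2; fun_prop) hs,
      ← lin _ _ _ _ c1 c2 s hs]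
    congr 1
    funext r
    simp only [Q2, Pi.sub_apply]
    ring
  · intro s hs
    have e : F31 / V1 * ffInt θ σ (L1 - L1') s + F32 / V2 * ffInt θ σ (L2 - L2') s
        = ffInt θ σ (fun r => F31 / V1 * (L1 - L1') r - -(F32 / V2) * (L2 - L2') r) s := by
      rw [lin _ _ _ _ c1 c2 s hs]
      ring
    have cc : ContinuousOn (fun r => F31 / V1 * (L1 - L1') r - -(F32 / V2) * (L2 - L2') r)
        (Icc 0 S) := (c1.const_mul _).sub (c2.const_mul _)
    rw [Pi.sub_apply, hE3 s hs, hE3' s hs, add_sub_add_left_eq_sub,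
      ← ffInt_sub hθ.1 hσ.1 (by unfold Q3; fun_prop) (by unfold Q3; fun_prop) hs, e,
      ← ffInt_const_mul, ← ffInt_sub hθ.1 hσ.1 cc (c3.const_mul _) hs]
    congr 1
    funext r
    simp only [Q3, Pi.sub_apply]
    ring
end

section
/- Second kernel integral of the Newton-polynomial scheme (equation (75), in the corrected form used in (79)): Let θ > 0, h > 0, and let k, ℓ be natural numbers with 2 ≤ ℓ ≤ k. With s_j = j·h, one has ∫_{s_ℓ}^{s_{ℓ+1}} (w − s_{ℓ−2})·(s_{k+1} − w)^{θ−1} dw = (h^{θ+1}/(θ(θ+1)))·[ (k−ℓ+1)^θ·(k−ℓ+3+2θ) − (k−ℓ)^θ·(k−ℓ+3+3θ) ]. -/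
open intervalIntegral

/-- For `θ > 0` and nonnegative endpoints,
`∫ (d - u) u^(θ-1) du = d (b^θ - a^θ) / θ - (b^(θ+1) - a^(θ+1)) / (θ+1)`. -/
theorem integral_sub_mul_rpow_sub_one {θ a b : ℝ} (d : ℝ) (hθ : 0 < θ) (ha : 0 ≤ a)
    (hb : 0 ≤ b) :
    ∫ u in a..b, (d - u) * u ^ (θ - 1)
      = d * ((b ^ θ - a ^ θ) / θ) - (b ^ (θ + 1) - a ^ (θ + 1)) / (θ + 1) := by
  have hcongr : Set.EqOn (fun u : ℝ => (d - u) * u ^ (θ - 1))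
      (fun u => d * u ^ (θ - 1) - u ^ θ) (Set.uIcc a b) := by
    intro u hu
    have hu0 : 0 ≤ u := (le_min ha hb).trans hu.1
    have hpow : u ^ θ = u ^ (θ - 1) * u := by
      rw [← Real.rpow_add_one' hu0 (by simpa using hθ.ne'), sub_add_cancel]
    simp only [hpow]
    ring
  rw [integral_congr hcongr,
    integral_sub ((intervalIntegrable_rpow' (by linarith)).const_mul d)
      (intervalIntegrable_rpow' (by linarith)),
    integral_const_mul, integral_rpow (Or.inl (by linarith)),
    integral_rpow (Or.inl (by linarith)), sub_add_cancel]

/-- Second kernel integral of the Newton-polynomial scheme (equation (75), in the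
corrected form used in (79)):
`∫_{s_ℓ}^{s_{ℓ+1}} (w − s_{ℓ−2})(s_{k+1} − w)^{θ−1} dw
  = (h^{θ+1}/(θ(θ+1)))·[(k−ℓ+1)^θ(k−ℓ+3+2θ) − (k−ℓ)^θ(k−ℓ+3+3θ)]`
with `s_j = j·h`. -/
theorem newton_kernel_integral_two
    (θ h : ℝ) (hθ : 0 < θ) (hh : 0 < h) (k ℓ : ℕ) (hℓ : 2 ≤ ℓ) (hkℓ : ℓ ≤ k) :
    ∫ w in ((ℓ : ℝ) * h)..(((ℓ : ℝ) + 1) * h),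
        (w - ((ℓ : ℝ) - 2) * h) * (((k : ℝ) + 1) * h - w) ^ (θ - 1)
      = h ^ (θ + 1) / (θ * (θ + 1))
          * (((k : ℝ) - (ℓ : ℝ) + 1) ^ θ * ((k : ℝ) - (ℓ : ℝ) + 3 + 2 * θ)
            - ((k : ℝ) - (ℓ : ℝ)) ^ θ * ((k : ℝ) - (ℓ : ℝ) + 3 + 3 * θ)) := by
  have hm : (0 : ℝ) ≤ (k : ℝ) - ℓ := sub_nonneg.2 (by exact_mod_cast hkℓ)
  have hsub := integral_comp_sub_left (a := (ℓ : ℝ) * h) (b := ((ℓ : ℝ) + 1) * h)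
    (fun u : ℝ => (((k : ℝ) - ℓ + 3) * h - u) * u ^ (θ - 1)) (((k : ℝ) + 1) * h)
  have hintegrand : ∀ w : ℝ, ((k : ℝ) - ℓ + 3) * h - (((k : ℝ) + 1) * h - w)
      = w - ((ℓ : ℝ) - 2) * h := fun w => by ring
  have hlower : ((k : ℝ) + 1) * h - ((ℓ : ℝ) + 1) * h = ((k : ℝ) - ℓ) * h := by ring
  have hupper : ((k : ℝ) + 1) * h - (ℓ : ℝ) * h = ((k : ℝ) - ℓ + 1) * h := by ring
  simp only [hintegrand, hlower, hupper] at hsub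
  rw [hsub]
  generalize (k : ℝ) - ℓ = m at hm ⊢
  have hm1 : 0 ≤ m + 1 := by linarith
  rw [integral_sub_mul_rpow_sub_one _ hθ (by positivity) (by positivity),
    Real.mul_rpow hm1 hh.le, Real.mul_rpow hm hh.le, Real.mul_rpow hm1 hh.le,
    Real.mul_rpow hm hh.le, Real.rpow_add_one' hm (by positivity),
    Real.rpow_add_one' hm1 (by positivity), Real.rpow_add_one' hh.le (by positivity)]
  field_simp
  ring
end

section
/- Third kernel integral of the Newton-polynomial scheme (equation (76)): Let θ > 0, h > 0, and let k, ℓ be natural numbers with 2 ≤ ℓ ≤ k. With s_j = j·h and a = k − ℓ, one has ∫_{s_ℓ}^{s_{ℓ+1}} (w − s_{ℓ−2})·(w − s_{ℓ−1})·(s_{k+1} − w)^{θ−1} dw = (h^{θ+2}/(θ(θ+1)(θ+2)))·[ (a+1)^θ·(2a² + (3θ+10)a + 2θ² + 9θ + 12) − a^θ·(2a² + (5θ+10)a + 6θ² + 18θ + 12) ]. -/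
open intervalIntegral

/-- Integral of a quadratic with roots `c`, `d` against the power kernel `x ^ (θ - 1)` over an
interval of nonnegative reals. -/
theorem integral_sub_mul_sub_mul_rpow {θ p q : ℝ} (hθ : 0 < θ) (hp : 0 ≤ p) (hq : 0 ≤ q)
    (c d : ℝ) :
    ∫ x in p..q, (c - x) * (d - x) * x ^ (θ - 1)
      = c * d * ((q ^ θ - p ^ θ) / θ) - (c + d) * ((q ^ θ * q - p ^ θ * p) / (θ + 1))
          + (q ^ θ * q ^ 2 - p ^ θ * p ^ 2) / (θ + 2) := by
  have pow_one {x : ℝ} (hx : 0 ≤ x) : x ^ (θ + 1) = x ^ θ * x :=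
    Real.rpow_add_one' hx (by positivity)
  have pow_two {x : ℝ} (hx : 0 ≤ x) : x ^ (θ + 1 + 1) = x ^ θ * x ^ 2 := by
    rw [Real.rpow_add_one' hx (by positivity), pow_one hx]
    ring
  have expand : ∫ x in p..q, (c - x) * (d - x) * x ^ (θ - 1)
      = ∫ x in p..q, (c * d * x ^ (θ - 1) - (c + d) * x ^ θ + x ^ (θ + 1)) := by
    refine intervalIntegral.integral_congr fun x hx => ?_
    have hx0 : 0 ≤ x := (le_min hp hq).trans hx.1
    have hxθ : x ^ θ = x ^ (θ - 1) * x := by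
      have := Real.rpow_add_one' (y := θ - 1) hx0 (by linarith)
      rwa [sub_add_cancel] at this
    simp only [pow_one hx0, hxθ]
    ring
  have int {r : ℝ} (hr : -1 < r) : IntervalIntegrable (fun x : ℝ => x ^ r) MeasureTheory.volume p q :=
    intervalIntegral.intervalIntegrable_rpow' hr
  have h₀ := (int (r := θ - 1) (by linarith)).const_mul (c * d)
  have h₁ := (int (r := θ) (by linarith)).const_mul (c + d)
  rw [expand, intervalIntegral.integral_add (h₀.sub h₁) (int (by linarith)),
    intervalIntegral.integral_sub h₀ h₁, intervalIntegral.integral_const_mul,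
    intervalIntegral.integral_const_mul, integral_rpow (Or.inl (by linarith)),
    integral_rpow (Or.inl (by linarith)), integral_rpow (Or.inl (by linarith)),
    sub_add_cancel, pow_one hp, pow_one hq, pow_two hp, pow_two hq]
  ring

/-- Third kernel integral of the Newton-polynomial scheme (equation (76)):
with `s_j = j·h` and `a = k − ℓ`,
`∫_{s_ℓ}^{s_{ℓ+1}} (w − s_{ℓ−2})(w − s_{ℓ−1})(s_{k+1} − w)^{θ−1} dw
  = (h^{θ+2}/(θ(θ+1)(θ+2)))·[(a+1)^θ(2a² + (3θ+10)a + 2θ² + 9θ + 12)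
      − a^θ(2a² + (5θ+10)a + 6θ² + 18θ + 12)]`. -/
theorem newton_kernel_integral_three
    (θ h : ℝ) (hθ : 0 < θ) (hh : 0 < h) (k ℓ : ℕ) (hℓ : 2 ≤ ℓ) (hkℓ : ℓ ≤ k) :
    ∫ w in ((ℓ : ℝ) * h)..(((ℓ : ℝ) + 1) * h),
        (w - ((ℓ : ℝ) - 2) * h) * (w - ((ℓ : ℝ) - 1) * h)
          * (((k : ℝ) + 1) * h - w) ^ (θ - 1)
      = h ^ (θ + 2) / (θ * (θ + 1) * (θ + 2))
          * (((k : ℝ) - (ℓ : ℝ) + 1) ^ θ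
                * (2 * ((k : ℝ) - (ℓ : ℝ)) ^ (2:ℕ) + (3 * θ + 10) * ((k : ℝ) - (ℓ : ℝ))
                    + 2 * θ ^ (2:ℕ) + 9 * θ + 12)
            - ((k : ℝ) - (ℓ : ℝ)) ^ θ
                * (2 * ((k : ℝ) - (ℓ : ℝ)) ^ (2:ℕ) + (5 * θ + 10) * ((k : ℝ) - (ℓ : ℝ))
                    + 6 * θ ^ (2:ℕ) + 18 * θ + 12)) := by
  have ha : (0 : ℝ) ≤ k - ℓ := sub_nonneg.2 (by exact_mod_cast hkℓ)
  have hpow : h ^ (θ + 2) = h ^ θ * h ^ 2 := by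
    rw [Real.rpow_add hh, Real.rpow_two]
  generalize hak : (k : ℝ) - ℓ = a at ha ⊢
  have hk : (k : ℝ) = ℓ + a := by linarith
  have reflect := intervalIntegral.integral_comp_sub_left (a := (ℓ : ℝ) * h)
    (b := ((ℓ : ℝ) + 1) * h)
    (fun x : ℝ => ((a + 3) * h - x) * ((a + 2) * h - x) * x ^ (θ - 1)) (((k : ℝ) + 1) * h)
  have hlower : ((k : ℝ) + 1) * h - ((ℓ : ℝ) + 1) * h = a * h := by rw [hk]; ring
  have hupper : ((k : ℝ) + 1) * h - (ℓ : ℝ) * h = (a + 1) * h := by rw [hk]; ring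
  rw [hlower, hupper, integral_sub_mul_sub_mul_rpow hθ (by positivity) (by positivity),
    Real.mul_rpow ha hh.le, Real.mul_rpow (by positivity) hh.le] at reflect
  rw [hpow]
  calc
    _ = ∫ w in ((ℓ : ℝ) * h)..(((ℓ : ℝ) + 1) * h),
        ((a + 3) * h - (((k : ℝ) + 1) * h - w)) * ((a + 2) * h - (((k : ℝ) + 1) * h - w))
          * (((k : ℝ) + 1) * h - w) ^ (θ - 1) := by
      congr 1 with w
      congr 1
      rw [hk]
      ring
    _ = _ := by
      rw [reflect]
      field_simp
      ring
end
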